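/- arXiv:0812.1335 — 9 statements merged into one kernel-verified Lean document; each statement's English description precedes it below -/
import Mathlib

section
/- Let γ, ν ∈ ℝ with ν ≠ 0 and γ/ν > 0, and let σ = ±1. Suppose u : ℝ × ℝ → ℂ is a smooth function of (x,t) satisfying the generalized nonlinear Schrödinger equation i·u_t − ν·u_{tx} + γ·u_{xx} + σ·|u|²·(u + i·ν·u_x) = 0 on ℝ². Then the gauge-transformed function w(x,t) := √(ν³/γ) · e^{−ix/ν} · u(x,t) satisfies w_{tx} + (γ/ν³)·w − (2iγ/ν²)·w_x − (γ/ν)·w_{xx} − (iγσ/ν³)·|w|²·w_x = 0 on ℝ². -/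
open Complex

/-- Partial derivative in the first (space) variable. -/
noncomputable def dX (f : ℝ × ℝ → ℂ) (p : ℝ × ℝ) : ℂ := fderiv ℝ f p (1, 0)

/-- Partial derivative in the second (time) variable. -/
noncomputable def dT (f : ℝ × ℝ → ℂ) (p : ℝ × ℝ) : ℂ := fderiv ℝ f p (0, 1)

/-- The gaugeW transformation `w(x,t) = √(ν³/γ) e^{-ix/ν} u(x,t)`. -/
noncomputable def gaugeW (γ ν : ℝ) (u : ℝ × ℝ → ℂ) : ℝ × ℝ → ℂ := fun q =>
  (Real.sqrt (ν ^ 3 / γ) : ℂ) * Complex.exp (-Complex.I * (q.1 : ℂ) / (ν : ℂ)) * u q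

theorem fderiv_gaugeW_apply (γ ν : ℝ) {f : ℝ × ℝ → ℂ} {p : ℝ × ℝ}
    (hf : DifferentiableAt ℝ f p) (v : ℝ × ℝ) :
    fderiv ℝ (gaugeW γ ν f) p v =
      (Real.sqrt (ν ^ 3 / γ) : ℂ) * Complex.exp (-Complex.I * (p.1 : ℂ) / (ν : ℂ)) *
        (fderiv ℝ f p v - Complex.I / (ν : ℂ) * (v.1 : ℂ) * f p) := by
  have h1 : HasFDerivAt (fun q : ℝ × ℝ => (q.1 : ℂ))
      (Complex.ofRealCLM.comp (ContinuousLinearMap.fst ℝ ℝ ℝ)) p :=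
    (Complex.ofRealCLM.comp (ContinuousLinearMap.fst ℝ ℝ ℝ)).hasFDerivAt
  have h2 := (((h1.const_mul (-Complex.I / (ν : ℂ))).cexp.const_mul
    (Real.sqrt (ν ^ 3 / γ) : ℂ)).mul hf.hasFDerivAt)
  have h3 : gaugeW γ ν f = fun q : ℝ × ℝ => (Real.sqrt (ν ^ 3 / γ) : ℂ) *
      Complex.exp (-Complex.I / (ν : ℂ) * (q.1 : ℂ)) * f q := by
    funext q
    simp only [gaugeW, div_mul_eq_mul_div]
  rw [(h2.congr_of_eventuallyEq (Filter.EventuallyEq.of_eq h3)).fderiv]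
  simp [div_mul_eq_mul_div]
  ring

theorem dX_gaugeW (γ ν : ℝ) {f : ℝ × ℝ → ℂ} (hf : Differentiable ℝ f) :
    dX (gaugeW γ ν f) = gaugeW γ ν (fun q => dX f q - Complex.I / (ν : ℂ) * f q) := by
  funext p
  rw [dX, fderiv_gaugeW_apply γ ν (hf p)]
  simp [gaugeW, dX]

theorem dT_gaugeW (γ ν : ℝ) {f : ℝ × ℝ → ℂ} (hf : Differentiable ℝ f) :
    dT (gaugeW γ ν f) = gaugeW γ ν (dT f) := by
  funext p
  rw [dT, fderiv_gaugeW_apply γ ν (hf p)]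
  simp [gaugeW, dT]

theorem fderiv_sub_const_mul_apply {f g : ℝ × ℝ → ℂ} {p : ℝ × ℝ} (c : ℂ)
    (hf : DifferentiableAt ℝ f p) (hg : DifferentiableAt ℝ g p) (v : ℝ × ℝ) :
    fderiv ℝ (fun q => f q - c * g q) p v = fderiv ℝ f p v - c * fderiv ℝ g p v := by
  rw [fderiv_fun_sub hf (hg.const_mul c), fderiv_const_mul hg]
  simp

theorem gaugeW_mul_conj {γ ν : ℝ} (h : 0 ≤ ν ^ 3 / γ) (f : ℝ × ℝ → ℂ) (p : ℝ × ℝ) :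
    gaugeW γ ν f p * (starRingEnd ℂ) (gaugeW γ ν f p) =
      (ν : ℂ) ^ 3 / (γ : ℂ) * (f p * (starRingEnd ℂ) (f p)) := by
  have hs : (Real.sqrt (ν ^ 3 / γ) : ℂ) * (Real.sqrt (ν ^ 3 / γ) : ℂ) =
      (ν : ℂ) ^ 3 / (γ : ℂ) := by
    exact_mod_cast Real.mul_self_sqrt h
  have he : Complex.exp (-Complex.I * (p.1 : ℂ) / (ν : ℂ)) *
      (starRingEnd ℂ) (Complex.exp (-Complex.I * (p.1 : ℂ) / (ν : ℂ))) = 1 := by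
    rw [← Complex.exp_conj, ← Complex.exp_add]
    simp [neg_div]
  simp only [gaugeW, map_mul, Complex.conj_ofReal]
  linear_combination (Complex.exp (-Complex.I * (p.1 : ℂ) / (ν : ℂ)) *
      (starRingEnd ℂ) (Complex.exp (-Complex.I * (p.1 : ℂ) / (ν : ℂ)))) *
      (f p * (starRingEnd ℂ) (f p)) * hs +
    (ν : ℂ) ^ 3 / (γ : ℂ) * (f p * (starRingEnd ℂ) (f p)) * he

theorem stmt0 (γ ν σ : ℝ) (hν : ν ≠ 0) (hγν : γ / ν > 0) (hσ : σ = 1 ∨ σ = -1)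
    (u : ℝ × ℝ → ℂ) (hu : ContDiff ℝ (⊤ : ℕ∞) u)
    (hPDE : ∀ p : ℝ × ℝ,
      Complex.I * dT u p - (ν : ℂ) * dT (dX u) p + (γ : ℂ) * dX (dX u) p
        + (σ : ℂ) * (u p * (starRingEnd ℂ) (u p)) * (u p + Complex.I * (ν : ℂ) * dX u p) = 0) :
    ∀ p : ℝ × ℝ,
      dT (dX (gaugeW γ ν u)) p + ((γ : ℂ) / (ν : ℂ) ^ 3) * gaugeW γ ν u p
        - (2 * Complex.I * (γ : ℂ) / (ν : ℂ) ^ 2) * dX (gaugeW γ ν u) p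
        - ((γ : ℂ) / (ν : ℂ)) * dX (dX (gaugeW γ ν u)) p
        - (Complex.I * (γ : ℂ) * (σ : ℂ) / (ν : ℂ) ^ 3)
            * (gaugeW γ ν u p * (starRingEnd ℂ) (gaugeW γ ν u p)) * dX (gaugeW γ ν u) p = 0 := by
  intro p
  have hγ : γ ≠ 0 := by
    rintro rfl
    simp at hγν
  have hc : 0 ≤ ν ^ 3 / γ := by
    have h : ν ^ 3 / γ = ν ^ 2 / (γ / ν) := by field_simp
    rw [h]
    positivity
  have hu1 : Differentiable ℝ u := hu.differentiable (by simp)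
  have hX : Differentiable ℝ (dX u) := by
    have h : ContDiff ℝ (⊤ : ℕ∞) (fderiv ℝ u) := hu.fderiv_right le_rfl
    exact (h.differentiable (by simp)).clm_apply (differentiable_const _)
  have hv : Differentiable ℝ (fun q => dX u q - Complex.I / (ν : ℂ) * u q) :=
    hX.sub (hu1.const_mul _)
  have hTv : dT (fun q => dX u q - Complex.I / (ν : ℂ) * u q) p =
      dT (dX u) p - Complex.I / (ν : ℂ) * dT u p :=
    fderiv_sub_const_mul_apply _ (hX p) (hu1 p) _
  have hXv : dX (fun q => dX u q - Complex.I / (ν : ℂ) * u q) p =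
      dX (dX u) p - Complex.I / (ν : ℂ) * dX u p :=
    fderiv_sub_const_mul_apply _ (hX p) (hu1 p) _
  rw [gaugeW_mul_conj hc, dX_gaugeW γ ν hu1, dT_gaugeW γ ν hv, dX_gaugeW γ ν hv]
  simp only [gaugeW, hTv, hXv]
  have hν' : (ν : ℂ) ≠ 0 := by exact_mod_cast hν
  have hγ' : (γ : ℂ) ≠ 0 := by exact_mod_cast hγ
  have hp := hPDE p
  generalize (Real.sqrt (ν ^ 3 / γ) : ℂ) * Complex.exp (-Complex.I * (p.1 : ℂ) / (ν : ℂ)) = A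
  generalize u p * (starRingEnd ℂ) (u p) = N at *
  have hI : Complex.I ^ 2 = -1 := Complex.I_sq
  have key : ∀ a b c d e : ℂ, Complex.I * a - ν * b + γ * c + σ * N * (d + Complex.I * ν * e) = 0 →
      A * (b - Complex.I / ν * a) + γ / ν ^ 3 * (A * d)
        - 2 * Complex.I * γ / ν ^ 2 * (A * (e - Complex.I / ν * d))
        - γ / ν * (A * (c - Complex.I / ν * e - Complex.I / ν * (e - Complex.I / ν * d)))
        - Complex.I * γ * σ / ν ^ 3 * (ν ^ 3 / γ * N) * (A * (e - Complex.I / ν * d)) = 0 := by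
    intro a b c d e h
    field_simp
    linear_combination (-A * ν ^ 2) * h + (A * γ * d + A * σ * N * d * ν ^ 2) * hI
  exact key _ _ _ _ _ hp
end

section
/- Let u : ℝ × ℝ → ℂ be a smooth function of (x,t) satisfying equation (GNLS2): u_{tx} + u − 2i·u_x − u_{xx} + i·|u|²·u_x = 0 on ℝ². Let σ₃ = [[1,0],[0,−1]], U(x,t) = [[0, u],[conj(u), 0]], and for ζ ∈ ℂ \ {0} set η = ζ − 1/(2ζ). Define the 2×2 matrix-valued functions P(x,t,ζ) = −iζ²σ₃ + ζ·U_x and Q(x,t,ζ) = −iη²σ₃ + ζ·U_x − (i/2)·σ₃·U² + (i/(2ζ))·σ₃·U. Then the zero-curvature (compatibility) condition ∂_t P − ∂_x Q + P·Q − Q·P = 0 holds for all (x,t) ∈ ℝ² and all ζ ∈ ℂ \ {0}. -/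
open Complex Matrix

/-- Equation (GNLS2): `u_{tx} + u - 2i u_x - u_{xx} + i |u|² u_x = 0`. -/
def GNLS2 (u : ℝ × ℝ → ℂ) : Prop :=
  ∀ p : ℝ × ℝ, dT (dX u) p + u p - 2 * Complex.I * dX u p - dX (dX u) p
    + Complex.I * (u p * (starRingEnd ℂ) (u p)) * dX u p = 0

noncomputable def sigma3 : Matrix (Fin 2) (Fin 2) ℂ := !![1, 0; 0, -1]

/-- `U(x,t) = [[0, u],[conj u, 0]]`. -/
noncomputable def Umat (u : ℝ × ℝ → ℂ) (p : ℝ × ℝ) : Matrix (Fin 2) (Fin 2) ℂ :=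
  !![0, u p; (starRingEnd ℂ) (u p), 0]

/-- `U_x(x,t) = [[0, u_x],[conj (u_x), 0]]`, the entrywise `x`-derivative of `U`. -/
noncomputable def UXmat (u : ℝ × ℝ → ℂ) (p : ℝ × ℝ) : Matrix (Fin 2) (Fin 2) ℂ :=
  !![0, dX u p; (starRingEnd ℂ) (dX u p), 0]

/-- `P(x,t,ζ) = -iζ²σ₃ + ζ U_x`. -/
noncomputable def Pmat (u : ℝ × ℝ → ℂ) (ζ : ℂ) (p : ℝ × ℝ) : Matrix (Fin 2) (Fin 2) ℂ :=
  (-Complex.I * ζ ^ 2) • sigma3 + ζ • UXmat u p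

/-- `Q(x,t,ζ) = -iη²σ₃ + ζ U_x - (i/2)σ₃U² + (i/(2ζ))σ₃U`, with `η = ζ - 1/(2ζ)`. -/
noncomputable def Qmat (u : ℝ × ℝ → ℂ) (ζ : ℂ) (p : ℝ × ℝ) : Matrix (Fin 2) (Fin 2) ℂ :=
  (-Complex.I * (ζ - 1 / (2 * ζ)) ^ 2) • sigma3 + ζ • UXmat u p
    - (Complex.I / 2) • (sigma3 * (Umat u p * Umat u p))
    + (Complex.I / (2 * ζ)) • (sigma3 * Umat u p)

theorem fderiv_conj_comp_apply {f : ℝ × ℝ → ℂ} {p : ℝ × ℝ} (hf : DifferentiableAt ℝ f p)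
    (v : ℝ × ℝ) :
    fderiv ℝ (fun q => (starRingEnd ℂ) (f q)) p v = (starRingEnd ℂ) (fderiv ℝ f p v) := by
  have h := (Complex.conjCLE.toContinuousLinearMap.hasFDerivAt.comp p hf.hasFDerivAt).fderiv
  have h' := congrArg (fun L : ℝ × ℝ →L[ℝ] ℂ => L v) h
  simpa [Function.comp_def] using h'

theorem fderiv_const_add_const_mul_apply {f : ℝ × ℝ → ℂ} {p : ℝ × ℝ}
    (hf : DifferentiableAt ℝ f p) (a b : ℂ) (v : ℝ × ℝ) :
    fderiv ℝ (fun q => a + b * f q) p v = b * fderiv ℝ f p v := by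
  rw [((hf.hasFDerivAt.const_mul b).const_add a).fderiv]
  simp

theorem fderiv_const_mul_add_const_mul_apply {f g : ℝ × ℝ → ℂ} {p : ℝ × ℝ}
    (hf : DifferentiableAt ℝ f p) (hg : DifferentiableAt ℝ g p) (a b : ℂ) (v : ℝ × ℝ) :
    fderiv ℝ (fun q => a * f q + b * g q) p v
      = a * fderiv ℝ f p v + b * fderiv ℝ g p v := by
  rw [((hf.hasFDerivAt.const_mul a).fun_add (hg.hasFDerivAt.const_mul b)).fderiv]
  simp

theorem fderiv_mul_conj_apply {f : ℝ × ℝ → ℂ} {p : ℝ × ℝ}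
    (hf : DifferentiableAt ℝ f p) (v : ℝ × ℝ) :
    fderiv ℝ (fun q => f q * (starRingEnd ℂ) (f q)) p v
      = f p * (starRingEnd ℂ) (fderiv ℝ f p v) + (starRingEnd ℂ) (f p) * fderiv ℝ f p v := by
  have hc : DifferentiableAt ℝ (fun q => (starRingEnd ℂ) (f q)) p :=
    Complex.conjCLE.differentiableAt.comp p hf
  rw [(hf.hasFDerivAt.fun_mul hc.hasFDerivAt).fderiv]
  simp [fderiv_conj_comp_apply hf]

theorem Pmat_eq (u : ℝ × ℝ → ℂ) (ζ : ℂ) (q : ℝ × ℝ) :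
    Pmat u ζ q = !![-I * ζ ^ 2, ζ * dX u q; ζ * (starRingEnd ℂ) (dX u q), I * ζ ^ 2] := by
  ext i j
  fin_cases i <;> fin_cases j <;> simp [Pmat, sigma3, UXmat]

theorem Qmat_eq (u : ℝ × ℝ → ℂ) (ζ : ℂ) (q : ℝ × ℝ) :
    Qmat u ζ q =
      !![-I * (ζ - 1 / (2 * ζ)) ^ 2 + -(I / 2) * (u q * (starRingEnd ℂ) (u q)),
          ζ * dX u q + I / (2 * ζ) * u q;
        ζ * (starRingEnd ℂ) (dX u q) + -(I / (2 * ζ)) * (starRingEnd ℂ) (u q),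
          I * (ζ - 1 / (2 * ζ)) ^ 2 + I / 2 * (u q * (starRingEnd ℂ) (u q))] := by
  ext i j
  fin_cases i <;> fin_cases j <;>
    simp [Qmat, sigma3, UXmat, Umat] <;> ring

theorem stmt1 (u : ℝ × ℝ → ℂ) (hu : ContDiff ℝ (⊤ : ℕ∞) u) (hPDE : GNLS2 u) :
    ∀ (p : ℝ × ℝ) (ζ : ℂ), ζ ≠ 0 →
      (Matrix.of fun i j => dT (fun q => Pmat u ζ q i j) p)
        - (Matrix.of fun i j => dX (fun q => Qmat u ζ q i j) p)
        + (Pmat u ζ p * Qmat u ζ p - Qmat u ζ p * Pmat u ζ p) = 0 := by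
  intro p ζ hζ
  have hd : DifferentiableAt ℝ u p := (hu.differentiable (by simp)).differentiableAt
  have hdX : DifferentiableAt ℝ (dX u) p :=
    ((hu.fderiv_right (m := 1) (WithTop.coe_le_coe.2 le_top)).differentiable one_ne_zero
      |>.differentiableAt).clm_apply (differentiableAt_const _)
  have hdc : DifferentiableAt ℝ (fun q => (starRingEnd ℂ) (u q)) p :=
    Complex.conjCLE.differentiableAt.comp p hd
  have hdXc : DifferentiableAt ℝ (fun q => (starRingEnd ℂ) (dX u q)) p :=
    Complex.conjCLE.differentiableAt.comp p hdX
  have hN : DifferentiableAt ℝ (fun q => u q * (starRingEnd ℂ) (u q)) p := hd.mul hdc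
  have e := hPDE p
  have ec := congrArg (starRingEnd ℂ) e
  simp only [map_add, map_sub, map_mul, map_zero, conj_I, Complex.conj_conj,
    map_ofNat] at ec
  have hP1 (b : ℂ) : dT (fun q => b * dX u q) p = b * dT (dX u) p := by
    simpa [dT] using fderiv_const_add_const_mul_apply hdX 0 b (0, 1)
  have hP2 (b : ℂ) : dT (fun q => b * (starRingEnd ℂ) (dX u q)) p
      = b * (starRingEnd ℂ) (dT (dX u) p) := by
    simpa [dT, fderiv_conj_comp_apply hdX] using fderiv_const_add_const_mul_apply hdXc 0 b (0, 1)
  have hQ0 (a b : ℂ) : dX (fun q => a + b * (u q * (starRingEnd ℂ) (u q))) p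
      = b * (u p * (starRingEnd ℂ) (dX u p) + (starRingEnd ℂ) (u p) * dX u p) :=
    (fderiv_const_add_const_mul_apply hN a b (1, 0)).trans
      (congrArg (b * ·) (fderiv_mul_conj_apply hd (1, 0)))
  have hQ1 (a b : ℂ) : dX (fun q => a * dX u q + b * u q) p
      = a * dX (dX u) p + b * dX u p :=
    fderiv_const_mul_add_const_mul_apply hdX hd a b (1, 0)
  have hQ2 (a b : ℂ) :
      dX (fun q => a * (starRingEnd ℂ) (dX u q) + b * (starRingEnd ℂ) (u q)) p
      = a * (starRingEnd ℂ) (dX (dX u) p) + b * (starRingEnd ℂ) (dX u p) := by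
    refine (fderiv_const_mul_add_const_mul_apply hdXc hdc a b (1, 0)).trans ?_
    rw [fderiv_conj_comp_apply hdX, fderiv_conj_comp_apply hd]
    rfl
  have hc (a : ℂ) : dT (fun _ => a) p = 0 := by simp [dT]
  simp only [Pmat_eq, Qmat_eq]
  ext i j
  fin_cases i <;> fin_cases j <;>
    simp only [Matrix.add_apply, Matrix.sub_apply, Matrix.of_apply, Matrix.mul_apply,
      Fin.sum_univ_two, Matrix.cons_val', Matrix.cons_val_zero, Matrix.cons_val_one,
      Matrix.cons_val_fin_one, Fin.zero_eta, Fin.mk_one, Matrix.zero_apply,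
      hP1, hP2, hQ0, hQ1, hQ2, hc]
  · field_simp
    ring
  · field_simp
    linear_combination 4 * ζ ^ 2 * e - 4 * ζ ^ 2 * u p * I_sq
  · field_simp
    linear_combination 4 * ζ ^ 2 * ec - 4 * ζ ^ 2 * (starRingEnd ℂ) (u p) * I_sq
  · field_simp
    ring
end

section
/- Let α ∈ ℝ and g ∈ ℂ. For ζ ∈ ℂ \ {0} let η = ζ − 1/(2ζ), let σ₃ = [[1,0],[0,−1]], define W(ζ) = [[−(i/2)|g|², ζ·e^{iα}·g + (i/(2ζ))·g],[ζ·e^{−iα}·conj(g) − (i/(2ζ))·conj(g), (i/2)|g|²]], and define the diagonal matrix N(ζ) = [[i − 2e^{−iα}ζ², 0],[0, −e^{−iα} + 2iζ²]]. Then the intertwining relation (iη²σ₃ − W(1/(2ζ)))·N(ζ) = N(ζ)·(iη²σ₃ − W(ζ)) holds for every ζ ∈ ℂ \ {0}. -/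
open Complex Matrix

/-- The matrix `W(ζ)` at the boundary under the Robin condition `g₁ = e^{iα} g₀`. -/
noncomputable def Wmat (α : ℝ) (g : ℂ) (ζ : ℂ) : Matrix (Fin 2) (Fin 2) ℂ :=
  !![-(Complex.I / 2) * (g * (starRingEnd ℂ) g),
      ζ * Complex.exp (Complex.I * (α : ℂ)) * g + (Complex.I / (2 * ζ)) * g;
    ζ * Complex.exp (-Complex.I * (α : ℂ)) * (starRingEnd ℂ) g
        - (Complex.I / (2 * ζ)) * (starRingEnd ℂ) g,
      (Complex.I / 2) * (g * (starRingEnd ℂ) g)]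

/-- The intertwining diagonal matrix `N(ζ)`. -/
noncomputable def Nmat (α : ℝ) (ζ : ℂ) : Matrix (Fin 2) (Fin 2) ℂ :=
  !![Complex.I - 2 * Complex.exp (-Complex.I * (α : ℂ)) * ζ ^ 2, 0;
     0, -Complex.exp (-Complex.I * (α : ℂ)) + 2 * Complex.I * ζ ^ 2]

theorem stmt5 (α : ℝ) (g : ℂ) :
    ∀ ζ : ℂ, ζ ≠ 0 →
      ((Complex.I * (ζ - 1 / (2 * ζ)) ^ 2) • sigma3 - Wmat α g (1 / (2 * ζ))) * Nmat α ζ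
        = Nmat α ζ * ((Complex.I * (ζ - 1 / (2 * ζ)) ^ 2) • sigma3 - Wmat α g ζ) := by
  intro ζ hζ
  have hE : exp (I * (α : ℂ)) * exp (-I * (α : ℂ)) = 1 := by
    rw [← Complex.exp_add]; simp
  have hI : I ^ 2 = -1 := I_sq
  unfold Wmat Nmat sigma3
  generalize exp (I * (α : ℂ)) = E at *
  generalize exp (-I * (α : ℂ)) = e at *
  generalize (starRingEnd ℂ) g = g'
  ext i j
  fin_cases i <;> fin_cases j <;>
    simp [Matrix.mul_apply, Fin.sum_univ_two]
  · ring
  · field_simp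
    linear_combination g * (1 - 4 * ζ ^ 4) * hE + g * (1 - 4 * ζ ^ 4) * hI
  · field_simp
    ring
  · ring
end

section
/- Let γ ∈ (0, π), Δ₀ > 0, Σ₀ ∈ ℝ, x₀ ∈ ℝ. Define Σ(x,t) = −t − Δ₀²·cos(γ)·(x + (1 + 1/(4Δ₀⁴))·t) + Σ₀, θ(x,t) = Δ₀²·sin(γ)·(x − x₀ + (1 − 1/(4Δ₀⁴))·t), and u(x,t) = −(2i·sin(γ)/Δ₀)·e^{−iγ}·e^{−2iΣ(x,t)}/(e^{2θ(x,t)} + e^{iγ}·e^{−2θ(x,t)}). Then the denominator e^{2θ} + e^{iγ}e^{−2θ} is nonzero for all (x,t) ∈ ℝ², u is smooth on ℝ², and u satisfies equation (GNLS2): u_{tx} + u − 2i·u_x − u_{xx} + i·|u|²·u_x = 0 on ℝ². -/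
open Complex

/-- `Σ(x,t) = -t - Δ₀² cos γ (x + (1 + 1/(4Δ₀⁴)) t) + Σ₀`. -/
noncomputable def SigS (γ Δ0 S0 : ℝ) (p : ℝ × ℝ) : ℝ :=
  -p.2 - Δ0 ^ 2 * Real.cos γ * (p.1 + (1 + 1 / (4 * Δ0 ^ 4)) * p.2) + S0

/-- `θ(x,t) = Δ₀² sin γ (x - x₀ + (1 - 1/(4Δ₀⁴)) t)`. -/
noncomputable def thS (γ Δ0 x0 : ℝ) (p : ℝ × ℝ) : ℝ :=
  Δ0 ^ 2 * Real.sin γ * (p.1 - x0 + (1 - 1 / (4 * Δ0 ^ 4)) * p.2)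

/-- The four-parameter family of one-soliton solutions. -/
noncomputable def soliton (γ Δ0 S0 x0 : ℝ) (p : ℝ × ℝ) : ℂ :=
  -(2 * Complex.I * (Real.sin γ : ℂ) / (Δ0 : ℂ)) * Complex.exp (-Complex.I * (γ : ℂ))
      * Complex.exp (-2 * Complex.I * (SigS γ Δ0 S0 p : ℂ))
    / (Complex.exp (2 * (thS γ Δ0 x0 p : ℂ))
        + Complex.exp (Complex.I * (γ : ℂ)) * Complex.exp (-2 * (thS γ Δ0 x0 p : ℂ)))

/-- The exponential of a complex affine function on the plane. -/
noncomputable def expAffine (a b c : ℂ) (p : ℝ × ℝ) : ℂ :=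
  Complex.exp (a * (p.1 : ℂ) + b * (p.2 : ℂ) + c)

/-- The real-linear form `(x, t) ↦ a x + b t` with complex coefficients. -/
noncomputable def planeForm (a b : ℂ) : ℝ × ℝ →L[ℝ] ℂ :=
  a • (Complex.ofRealCLM.comp (ContinuousLinearMap.fst ℝ ℝ ℝ))
    + b • (Complex.ofRealCLM.comp (ContinuousLinearMap.snd ℝ ℝ ℝ))

lemma planeForm_apply (a b : ℂ) (v : ℝ × ℝ) : planeForm a b v = a * v.1 + b * v.2 := by
  simp [planeForm]

lemma hasFDerivAt_expAffine (a b c : ℂ) (p : ℝ × ℝ) :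
    HasFDerivAt (expAffine a b c) (expAffine a b c p • planeForm a b) p := by
  have h : HasFDerivAt (fun q : ℝ × ℝ => a * (q.1 : ℂ) + b * (q.2 : ℂ) + c) (planeForm a b) p := by
    have h := ((planeForm a b).hasFDerivAt (x := p)).add_const c
    simpa only [planeForm_apply] using h
  exact h.cexp

lemma hasFDerivAt_expAffine_add_inv (a b c z : ℂ) (p : ℝ × ℝ) (h : expAffine a b c p + z ≠ 0) :
    HasFDerivAt (fun q => (expAffine a b c q + z)⁻¹)
      ((-(expAffine a b c p / (expAffine a b c p + z) ^ 2)) • planeForm a b) p := by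
  have hQ := (hasFDerivAt_inv' (𝕜 := ℝ) h).comp p ((hasFDerivAt_expAffine a b c p).add_const z)
  refine hQ.congr_fderiv ?_
  ext <;> simp <;> field_simp

/-- The derivative of `P / (Q + z)` where `P` and `Q` are exponentials of affine functions. -/
lemma fderiv_expAffine_div (K z a b c a' b' c' : ℂ) (p v : ℝ × ℝ)
    (h : expAffine a' b' c' p + z ≠ 0) :
    fderiv ℝ (fun q => K * expAffine a b c q / (expAffine a' b' c' q + z)) p v =
      K * expAffine a b c p * (planeForm a b v * (expAffine a' b' c' p + z)
        - expAffine a' b' c' p * planeForm a' b' v) / (expAffine a' b' c' p + z) ^ 2 := by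
  have hP := (hasFDerivAt_expAffine a b c p).const_mul K
  have hQ := hasFDerivAt_expAffine_add_inv a' b' c' z p h
  simp only [div_eq_mul_inv]
  rw [(hP.fun_mul hQ).fderiv]
  simp
  field_simp
  ring

/-- The derivative of `P (Q + w) / (Q + z)²` where `P` and `Q` are exponentials of affine
functions. -/
lemma fderiv_expAffine_mul_div_sq (K z w a b c a' b' c' : ℂ) (p v : ℝ × ℝ)
    (h : expAffine a' b' c' p + z ≠ 0) :
    fderiv ℝ (fun q => K * expAffine a b c q * (expAffine a' b' c' q + w)
        / (expAffine a' b' c' q + z) ^ 2) p v =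
      K * expAffine a b c p * (planeForm a b v * (expAffine a' b' c' p + w)
        * (expAffine a' b' c' p + z)
        + expAffine a' b' c' p * planeForm a' b' v * (z - expAffine a' b' c' p - 2 * w))
        / (expAffine a' b' c' p + z) ^ 3 := by
  have hP := (hasFDerivAt_expAffine a b c p).const_mul K
  have hW := (hasFDerivAt_expAffine a' b' c' p).add_const w
  have hQ := hasFDerivAt_expAffine_add_inv a' b' c' z p h
  simp only [div_eq_mul_inv, ← inv_pow, pow_two (_⁻¹)]
  rw [((hP.fun_mul hW).fun_mul (hQ.fun_mul hQ)).fderiv]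
  simp
  field_simp
  ring

lemma exp_add_exp_ne_zero {γ : ℝ} (hγ : γ ∈ Set.Ioo 0 Real.pi) (r : ℝ) :
    Complex.exp (2 * (r : ℂ))
      + Complex.exp (Complex.I * (γ : ℂ)) * Complex.exp (-2 * (r : ℂ)) ≠ 0 := by
  intro h
  have hs := Real.sin_pos_of_mem_Ioo hγ
  have h' := congrArg Complex.im h
  have h1 : Complex.exp (2 * (r : ℂ)) = (Real.exp (2 * r) : ℝ) := by push_cast; rfl
  have h2 : Complex.exp (-2 * (r : ℂ)) = (Real.exp (-2 * r) : ℝ) := by push_cast; rfl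
  rw [h1, h2, Complex.add_im, Complex.im_mul_ofReal, Complex.ofReal_im, mul_comm Complex.I,
    Complex.exp_ofReal_mul_I_im, Complex.zero_im, zero_add] at h'
  exact (mul_pos hs (Real.exp_pos _)).ne' h'

lemma contDiff_soliton {γ : ℝ} (hγ : γ ∈ Set.Ioo 0 Real.pi) (Δ0 S0 x0 : ℝ) :
    ContDiff ℝ (⊤ : ℕ∞) (soliton γ Δ0 S0 x0) := by
  have hS : ContDiff ℝ (⊤ : ℕ∞) (fun p => (SigS γ Δ0 S0 p : ℂ)) := by
    refine Complex.ofRealCLM.contDiff.comp (f := SigS γ Δ0 S0) ?_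
    unfold SigS
    fun_prop
  have hT : ContDiff ℝ (⊤ : ℕ∞) (fun p => (thS γ Δ0 x0 p : ℂ)) := by
    refine Complex.ofRealCLM.contDiff.comp (f := thS γ Δ0 x0) ?_
    unfold thS
    fun_prop
  unfold soliton
  simp only [div_eq_mul_inv _ (_ + _)]
  refine ContDiff.mul (by fun_prop) (ContDiff.inv (by fun_prop) fun p => ?_)
  exact exp_add_exp_ne_zero hγ _

lemma sin_eq_exp (γ : ℝ) : (Real.sin γ : ℂ) =
    (Complex.exp (Complex.I * γ) - (Complex.exp (Complex.I * γ))⁻¹) / (2 * Complex.I) := by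
  rw [Complex.ofReal_sin, Complex.sin, ← Complex.exp_neg, mul_comm Complex.I, neg_mul]
  field_simp
  rw [Complex.I_sq]
  ring

lemma cos_eq_exp (γ : ℝ) : (Real.cos γ : ℂ) =
    (Complex.exp (Complex.I * γ) + (Complex.exp (Complex.I * γ))⁻¹) / 2 := by
  rw [Complex.ofReal_cos, Complex.cos, ← Complex.exp_neg, mul_comm Complex.I, neg_mul]

/-- The soliton as a quotient of exponentials of affine functions. -/
lemma soliton_eq (γ Δ0 S0 x0 : ℝ) (hΔ0 : Δ0 ≠ 0) (z d : ℂ) (hz : z = Complex.exp (Complex.I * γ))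
    (hd : d = (Δ0 : ℂ) ^ 2) (p : ℝ × ℝ) :
    soliton γ Δ0 S0 x0 p =
      -(2 * Complex.I * (Real.sin γ : ℂ) / (Δ0 : ℂ)) * z⁻¹
        * expAffine (2 * Complex.I * d / z)
          (2 * Complex.I + 2 * Complex.I * d / z + Complex.I * z / (2 * d))
          (-2 * Complex.I * S0 - 2 * d * (Real.sin γ : ℂ) * x0) p
        / (Complex.exp (4 * (thS γ Δ0 x0 p : ℂ)) + z) := by
  have hz0 : z ≠ 0 := hz ▸ Complex.exp_ne_zero _
  have hD : (Δ0 : ℂ) ≠ 0 := by exact_mod_cast hΔ0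
  have hP : expAffine (2 * Complex.I * d / z)
      (2 * Complex.I + 2 * Complex.I * d / z + Complex.I * z / (2 * d))
      (-2 * Complex.I * S0 - 2 * d * (Real.sin γ : ℂ) * x0) p =
      Complex.exp (-2 * Complex.I * (SigS γ Δ0 S0 p : ℂ))
        * Complex.exp (2 * (thS γ Δ0 x0 p : ℂ)) := by
    rw [← Complex.exp_add, expAffine]
    congr 1
    unfold SigS thS
    simp only [Complex.ofReal_add, Complex.ofReal_mul, Complex.ofReal_sub, Complex.ofReal_neg,
      Complex.ofReal_div, Complex.ofReal_pow, Complex.ofReal_one, Complex.ofReal_ofNat]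
    rw [sin_eq_exp, cos_eq_exp, ← hz, hd]
    field_simp
    ring_nf
    simp only [Complex.I_sq]
    ring
  have hQ : Complex.exp (4 * (thS γ Δ0 x0 p : ℂ)) = Complex.exp (2 * (thS γ Δ0 x0 p : ℂ)) ^ 2 := by
    rw [← Complex.exp_nat_mul]
    congr 1
    push_cast
    ring
  have ha := Complex.exp_ne_zero (2 * (thS γ Δ0 x0 p : ℂ))
  rw [hP, hQ, soliton, ← hz, neg_mul Complex.I, neg_mul 2 (thS γ Δ0 x0 p : ℂ), Complex.exp_neg,
    Complex.exp_neg, ← hz]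
  generalize Complex.exp (2 * (thS γ Δ0 x0 p : ℂ)) = a at *
  have hden : a + z * a⁻¹ = (a ^ 2 + z) / a := by field_simp
  rw [hden, div_div_eq_mul_div]
  ring

lemma exp_four_thS (γ Δ0 x0 : ℝ) (hΔ0 : Δ0 ≠ 0) (z d : ℂ) (hz : z = Complex.exp (Complex.I * γ))
    (hd : d = (Δ0 : ℂ) ^ 2) (p : ℝ × ℝ) :
    Complex.exp (4 * (thS γ Δ0 x0 p : ℂ)) =
      expAffine (-2 * Complex.I * d * (z - z⁻¹))
        (-2 * Complex.I * (d - 1 / (4 * d)) * (z - z⁻¹))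
        (-4 * d * (Real.sin γ : ℂ) * x0) p := by
  have hz0 : z ≠ 0 := hz ▸ Complex.exp_ne_zero _
  have hD : (Δ0 : ℂ) ≠ 0 := by exact_mod_cast hΔ0
  rw [expAffine]
  congr 1
  unfold thS
  simp only [Complex.ofReal_add, Complex.ofReal_mul, Complex.ofReal_sub,
    Complex.ofReal_div, Complex.ofReal_pow, Complex.ofReal_one, Complex.ofReal_ofNat]
  rw [sin_eq_exp, ← hz, hd]
  field_simp
  ring_nf
  simp only [Complex.I_sq]
  ring

lemma ofReal_add_exp_ne_zero {γ : ℝ} (hγ : Real.sin γ ≠ 0) (r : ℝ) :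
    (r : ℂ) + Complex.exp (Complex.I * γ) ≠ 0 := by
  intro h
  have h' := congrArg Complex.im h
  rw [mul_comm Complex.I, Complex.add_im, Complex.exp_ofReal_mul_I_im] at h'
  simp [hγ] at h'

/-- The squared modulus of the soliton. -/
lemma soliton_mul_conj (γ Δ0 S0 x0 : ℝ) (z Q : ℂ) (hz : z = Complex.exp (Complex.I * γ))
    (p : ℝ × ℝ) (hQ : Q = Complex.exp (4 * (thS γ Δ0 x0 p : ℂ))) :
    soliton γ Δ0 S0 x0 p * (starRingEnd ℂ) (soliton γ Δ0 S0 x0 p) =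
      4 * (Real.sin γ : ℂ) ^ 2 / (Δ0 : ℂ) ^ 2 * Q / ((Q + z) * (Q + z⁻¹)) := by
  have hz0 : z ≠ 0 := hz ▸ Complex.exp_ne_zero _
  have hE := Complex.exp_ne_zero (2 * Complex.I * (SigS γ Δ0 S0 p : ℂ))
  have ha := Complex.exp_ne_zero (2 * (thS γ Δ0 x0 p : ℂ))
  have hQ' : Q = Complex.exp (2 * (thS γ Δ0 x0 p : ℂ)) ^ 2 := by
    rw [hQ, ← Complex.exp_nat_mul]
    congr 1
    push_cast
    ring
  rw [soliton]
  simp only [map_div₀, map_mul, map_neg, map_add, ← Complex.exp_conj, Complex.conj_I,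
    Complex.conj_ofReal, map_ofNat, neg_mul, mul_neg]
  simp only [Complex.exp_neg, ← hz]
  rw [hQ']
  generalize Complex.exp (2 * (thS γ Δ0 x0 p : ℂ)) = a at *
  generalize Complex.exp (2 * Complex.I * (SigS γ Δ0 S0 p : ℂ)) = E at *
  have h1 : a + z * a⁻¹ = (a ^ 2 + z) / a := by field_simp
  have h2 : a + z⁻¹ * a⁻¹ = (a ^ 2 + z⁻¹) / a := by field_simp
  rw [h1, h2, div_div_eq_mul_div, div_div_eq_mul_div, div_mul_div_comm]
  congr 1
  field_simp
  rw [Complex.I_sq]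
  ring

lemma gnls2_soliton {γ Δ0 : ℝ} (hγ : Real.sin γ ≠ 0) (hΔ0 : Δ0 ≠ 0) (S0 x0 : ℝ) :
    GNLS2 (soliton γ Δ0 S0 x0) := by
  obtain ⟨z, hz⟩ : ∃ z, z = Complex.exp (Complex.I * γ) := ⟨_, rfl⟩
  obtain ⟨d, hd⟩ : ∃ d, d = (Δ0 : ℂ) ^ 2 := ⟨_, rfl⟩
  have hz0 : z ≠ 0 := hz ▸ Complex.exp_ne_zero _
  have hd0 : d ≠ 0 := by rw [hd]; exact pow_ne_zero 2 (by exact_mod_cast hΔ0)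
  have hs := sin_eq_exp γ
  rw [← hz] at hs
  have hQθ := exp_four_thS γ Δ0 x0 hΔ0 z d hz hd
  have hmod := fun p => soliton_mul_conj γ Δ0 S0 x0 z _ hz p rfl
  have hu := soliton_eq γ Δ0 S0 x0 hΔ0 z d hz hd
  have hne : ∀ p, Complex.exp (4 * (thS γ Δ0 x0 p : ℂ)) + z ≠ 0 := fun p => by
    have h := ofReal_add_exp_ne_zero hγ (Real.exp (4 * thS γ Δ0 x0 p))
    rw [hz]
    push_cast at h
    exact h
  have hne' : ∀ p, Complex.exp (4 * (thS γ Δ0 x0 p : ℂ)) + z⁻¹ ≠ 0 := fun p => by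
    have h := ofReal_add_exp_ne_zero (γ := -γ) (by simpa using hγ) (Real.exp (4 * thS γ Δ0 x0 p))
    rw [hz, ← Complex.exp_neg]
    push_cast at h
    rwa [mul_neg] at h
  simp only [hQθ] at hne hne' hmod hu
  generalize -(2 * Complex.I * (Real.sin γ : ℂ) / (Δ0 : ℂ)) * z⁻¹ = K at hu
  generalize -2 * Complex.I * S0 - 2 * d * (Real.sin γ : ℂ) * x0 = c at *
  generalize -4 * d * (Real.sin γ : ℂ) * x0 = c' at *
  have hux : dX (soliton γ Δ0 S0 x0) = fun p =>
      2 * Complex.I * d * z * K * expAffine (2 * Complex.I * d / z)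
          (2 * Complex.I + 2 * Complex.I * d / z + Complex.I * z / (2 * d)) c p
        * (expAffine (-2 * Complex.I * d * (z - z⁻¹))
          (-2 * Complex.I * (d - 1 / (4 * d)) * (z - z⁻¹)) c' p + z⁻¹)
        / (expAffine (-2 * Complex.I * d * (z - z⁻¹))
          (-2 * Complex.I * (d - 1 / (4 * d)) * (z - z⁻¹)) c' p + z) ^ 2 := by
    funext p
    rw [dX, funext hu, fderiv_expAffine_div _ _ _ _ _ _ _ _ _ _ (hne p)]
    simp only [planeForm_apply]
    congr 1
    push_cast
    field_simp
    ring
  intro p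
  rw [hmod, hux]
  simp only [dX, dT]
  rw [fderiv_expAffine_mul_div_sq _ _ _ _ _ _ _ _ _ _ _ (hne p),
    fderiv_expAffine_mul_div_sq _ _ _ _ _ _ _ _ _ _ _ (hne p), hu p, hs, ← hd]
  simp only [planeForm_apply]
  have h1 := hne p
  have h2 := hne' p
  generalize expAffine (-2 * Complex.I * d * (z - z⁻¹)) _ c' p = Q at *
  generalize expAffine (2 * Complex.I * d / z) _ c p = P at *
  have h3 : 1 + z * Q ≠ 0 := by
    intro h
    apply h2
    field_simp
    linear_combination h
  push_cast
  field_simp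
  ring_nf
  simp only [Complex.I_sq]
  field_simp
  ring

theorem stmt7 (γ Δ0 S0 x0 : ℝ) (hγ : γ ∈ Set.Ioo 0 Real.pi) (hΔ0 : 0 < Δ0) :
    (∀ p : ℝ × ℝ,
      Complex.exp (2 * (thS γ Δ0 x0 p : ℂ))
        + Complex.exp (Complex.I * (γ : ℂ)) * Complex.exp (-2 * (thS γ Δ0 x0 p : ℂ)) ≠ 0) ∧
    ContDiff ℝ (⊤ : ℕ∞) (soliton γ Δ0 S0 x0) ∧
    GNLS2 (soliton γ Δ0 S0 x0) := by
  have hs : Real.sin γ ≠ 0 := (Real.sin_pos_of_mem_Ioo hγ).ne'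
  exact ⟨fun p => exp_add_exp_ne_zero hγ _, contDiff_soliton hγ Δ0 S0 x0,
    gnls2_soliton hs hΔ0.ne' S0 x0⟩
end

section
/- Let γ ∈ (0, π) and x₀ ∈ ℝ. Then 1 + e^{−iγ − 2x₀·sin(γ)} ≠ 0 and exp(i·(2·arctan(tan(γ/2)·tanh(−x₀·sin(γ))) + γ)) = (1 + e^{iγ − 2x₀·sin(γ)})/(1 + e^{−iγ − 2x₀·sin(γ)}). -/
open Complex

theorem exp_two_arctan_mul_I (t : ℝ) :
    cexp (I * (2 * Real.arctan t : ℝ)) * (1 - I * t) = 1 + I * t := by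
  set θ := Real.arctan t with hθ
  have hC : (Real.cos θ : ℂ) ≠ 0 := by exact_mod_cast (Real.cos_arctan_pos t).ne'
  have hS : (Real.sin θ : ℂ) = t * Real.cos θ := by
    have h : Real.sin θ = t * Real.cos θ := by
      rw [hθ, ← Real.tan_mul_cos (Real.cos_arctan_pos t).ne', Real.tan_arctan]
    exact_mod_cast h
  have hp : cexp (θ * I) = Real.cos θ * (1 + I * t) := by
    rw [exp_mul_I, ← ofReal_cos, ← ofReal_sin, hS]; ring
  have hm : cexp (-θ * I) = Real.cos θ * (1 - I * t) := by
    rw [exp_mul_I, Complex.cos_neg, Complex.sin_neg, ← ofReal_cos, ← ofReal_sin, hS]; ring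
  have h : cexp (I * (2 * θ : ℝ)) * cexp (-θ * I) = cexp (θ * I) := by
    rw [← Complex.exp_add]; congr 1; push_cast; ring
  rw [hp, hm] at h
  exact mul_left_cancel₀ hC (by linear_combination h)

theorem tanh_mul_exp_two_mul_add_one (a : ℝ) :
    Real.tanh a * (Real.exp (2 * a) + 1) = Real.exp (2 * a) - 1 := by
  have h : Real.exp (2 * a) = Real.exp a * Real.exp a := by rw [← Real.exp_add]; ring_nf
  have := Real.exp_pos a
  rw [Real.tanh_eq_sinh_div_cosh, Real.sinh_eq, Real.cosh_eq, h, Real.exp_neg]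
  field_simp

theorem one_add_exp_neg_I_mul_sub_ne_zero {γ : ℝ} (hγ : Real.sin γ ≠ 0) (b : ℝ) :
    (1 : ℂ) + cexp (-I * γ - b) ≠ 0 := by
  intro h
  have := congrArg Complex.im h
  simp [Complex.exp_im, hγ] at this

theorem stmt11 (γ x0 : ℝ) (hγ : γ ∈ Set.Ioo 0 Real.pi) :
    (1 : ℂ) + Complex.exp (-Complex.I * (γ : ℂ) - 2 * (x0 : ℂ) * (Real.sin γ : ℂ)) ≠ 0 ∧
    Complex.exp (Complex.I *
        ((2 * Real.arctan (Real.tan (γ / 2) * Real.tanh (-x0 * Real.sin γ)) + γ : ℝ) : ℂ))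
      = ((1 : ℂ) + Complex.exp (Complex.I * (γ : ℂ) - 2 * (x0 : ℂ) * (Real.sin γ : ℂ)))
        / ((1 : ℂ) + Complex.exp (-Complex.I * (γ : ℂ) - 2 * (x0 : ℂ) * (Real.sin γ : ℂ))) := by
  obtain ⟨h0, hpi⟩ := hγ
  have hne : (1 : ℂ) + cexp (-I * γ - 2 * x0 * (Real.sin γ : ℂ)) ≠ 0 := by
    have := one_add_exp_neg_I_mul_sub_ne_zero (Real.sin_pos_of_pos_of_lt_pi h0 hpi).ne'
      (2 * x0 * Real.sin γ)
    rwa [ofReal_mul, ofReal_mul, ofReal_ofNat] at this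
  refine ⟨hne, ?_⟩
  rw [eq_div_iff hne]
  set a := -x0 * Real.sin γ with ha
  set t := Real.tan (γ / 2) * Real.tanh a with ht
  have hc : Real.cos (γ / 2) ≠ 0 :=
    (Real.cos_pos_of_mem_Ioo ⟨by linarith, by linarith⟩).ne'
  have htE : (t : ℂ) * (Real.cos (γ / 2) * (Real.exp (2 * a) + 1))
      = Real.sin (γ / 2) * (Real.exp (2 * a) - 1) := by
    have h : t * (Real.cos (γ / 2) * (Real.exp (2 * a) + 1))
        = Real.sin (γ / 2) * (Real.exp (2 * a) - 1) := by
      rw [← tanh_mul_exp_two_mul_add_one, ← Real.tan_mul_cos hc, ht]; ring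
    exact_mod_cast h
  have hP := exp_two_arctan_mul_I t
  set u := cexp ((γ / 2 : ℝ) * I) with hu
  set v := cexp (-(γ / 2 : ℝ) * I) with hv
  have hu' : u = Real.cos (γ / 2) + Real.sin (γ / 2) * I := by
    rw [hu, exp_mul_I, ofReal_cos, ofReal_sin]
  have hv' : v = Real.cos (γ / 2) - Real.sin (γ / 2) * I := by
    rw [hv, exp_mul_I, Complex.cos_neg, Complex.sin_neg, ofReal_cos, ofReal_sin]; ring
  have huv : u * v = 1 := by
    rw [hu, hv, ← Complex.exp_add, neg_mul, add_neg_cancel, Complex.exp_zero]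
  have hplus : cexp (I * γ - 2 * x0 * (Real.sin γ : ℂ)) = Real.exp (2 * a) * u ^ 2 := by
    rw [hu, ← Complex.exp_nat_mul, ofReal_exp, ← Complex.exp_add, ha]
    congr 1; push_cast; ring
  have hminus : cexp (-I * γ - 2 * x0 * (Real.sin γ : ℂ)) = Real.exp (2 * a) * v ^ 2 := by
    rw [hv, ← Complex.exp_nat_mul, ofReal_exp, ← Complex.exp_add, ha]
    congr 1; push_cast; ring
  have hsum : cexp (I * (2 * Real.arctan t + γ : ℝ))
      = cexp (I * (2 * Real.arctan t : ℝ)) * u ^ 2 := by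
    rw [hu, ← Complex.exp_nat_mul, ← Complex.exp_add]
    congr 1; push_cast; ring
  rw [hplus, hminus, hsum]
  set P := cexp (I * (2 * Real.arctan t : ℝ))
  set E : ℂ := (Real.exp (2 * a) : ℂ)
  have key : P * (E * v + u) = E * u + v := by
    rw [hu', hv']
    linear_combination (Real.cos (γ / 2) * (E + 1) : ℂ) * hP + (P + 1) * I * htE
  linear_combination u * key + (P * E * u * v + 1) * huv
end

section
/- Fix γ ∈ (0, π) and Σ₀ ∈ ℝ. For x₀ ∈ ℝ define ζ₁²(x₀) := −(1/2)·cos((γ + 2i·x₀·sin(γ))/2)/cos((γ − 2i·x₀·sin(γ))/2), and for ζ ∈ ℂ with 2ζ² + e^{iγ} ≠ 0 define b(ζ; x₀) := 2√2·e^{x₀ sin γ − 2i(γ + Σ₀)}·(e^{iγ} + e^{2x₀ sin γ})²·ζ·sin(γ) / [(1 + e^{iγ + 2x₀ sin γ})²·(2ζ² + e^{iγ})·(e^{2x₀ sin γ}·(i·cos γ + sin γ) + i)]. Then: (i) ζ₁²(x₀) → (1/2)·(i·sin(γ) − cos(γ)) as x₀ → +∞; (ii) for every fixed such ζ, b(ζ;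 x₀) is defined for all sufficiently large x₀ and b(ζ; x₀) → 0 as x₀ → +∞. -/
open Complex Filter

/-- `ζ₁²(x₀) = -(1/2) cos((γ + 2i x₀ sin γ)/2) / cos((γ - 2i x₀ sin γ)/2)`. -/
noncomputable def zeta1sq (γ x0 : ℝ) : ℂ :=
  -(1 / 2) * Complex.cos (((γ : ℂ) + 2 * Complex.I * (x0 : ℂ) * (Real.sin γ : ℂ)) / 2)
    / Complex.cos (((γ : ℂ) - 2 * Complex.I * (x0 : ℂ) * (Real.sin γ : ℂ)) / 2)

/-- The denominator of the spectral function `b(ζ; x₀)`. -/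
noncomputable def bDen (γ : ℝ) (ζ : ℂ) (x0 : ℝ) : ℂ :=
  (1 + Complex.exp (Complex.I * (γ : ℂ) + 2 * (x0 : ℂ) * (Real.sin γ : ℂ))) ^ 2
    * (2 * ζ ^ 2 + Complex.exp (Complex.I * (γ : ℂ)))
    * (Complex.exp (2 * (x0 : ℂ) * (Real.sin γ : ℂ))
        * (Complex.I * (Real.cos γ : ℂ) + (Real.sin γ : ℂ)) + Complex.I)

/-- The spectral function `b(ζ; x₀)`. -/
noncomputable def bFun (γ S0 : ℝ) (ζ : ℂ) (x0 : ℝ) : ℂ :=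
  2 * (Real.sqrt 2 : ℂ)
      * Complex.exp ((x0 * Real.sin γ : ℝ) - 2 * Complex.I * ((γ : ℂ) + (S0 : ℂ)))
      * (Complex.exp (Complex.I * (γ : ℂ)) + Complex.exp (2 * (x0 : ℂ) * (Real.sin γ : ℂ))) ^ 2
      * ζ * (Real.sin γ : ℂ)
    / bDen γ ζ x0

/-- The decaying exponential `exp (-x₀ sin γ)` in which all spectral quantities are rational. -/
noncomputable def decayExp (γ x0 : ℝ) : ℂ := Complex.exp (-((x0 : ℂ) * (Real.sin γ : ℂ)))

lemma decayExp_ne_zero (γ x0 : ℝ) : decayExp γ x0 ≠ 0 := Complex.exp_ne_zero _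

lemma tendsto_decayExp {γ : ℝ} (hγ : γ ∈ Set.Ioo 0 Real.pi) :
    Tendsto (decayExp γ) atTop (nhds 0) := by
  have hs : 0 < Real.sin γ := Real.sin_pos_of_mem_Ioo hγ
  have h : Tendsto (fun x0 : ℝ => Real.exp (-(x0 * Real.sin γ))) atTop (nhds 0) :=
    Real.tendsto_exp_neg_atTop_nhds_zero.comp (tendsto_id.atTop_mul_const hs)
  have h' := (Complex.continuous_ofReal.tendsto 0).comp h
  simp only [Complex.ofReal_zero] at h'
  refine h'.congr fun x0 => ?_
  simp [decayExp]

lemma exp_eq_inv_decayExp (γ x0 : ℝ) :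
    Complex.exp ((x0 : ℂ) * (Real.sin γ : ℂ)) = (decayExp γ x0)⁻¹ := by
  rw [decayExp, Complex.exp_neg, inv_inv]

lemma exp_two_eq_inv_decayExp_sq (γ x0 : ℝ) :
    Complex.exp (2 * (x0 : ℂ) * (Real.sin γ : ℂ)) = (decayExp γ x0 ^ 2)⁻¹ := by
  rw [decayExp, ← Complex.exp_nat_mul, ← Complex.exp_neg]
  congr 1
  push_cast
  ring

lemma zeta1sq_eq (γ x0 : ℝ) :
    zeta1sq γ x0 =
      -(1 / 2) * (Complex.exp (I * γ / 2) * decayExp γ x0 ^ 2 + Complex.exp (-(I * γ / 2)))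
        / (Complex.exp (I * γ / 2) + Complex.exp (-(I * γ / 2)) * decayExp γ x0 ^ 2) := by
  have hu := decayExp_ne_zero γ x0
  have e₁ : Complex.exp (((γ : ℂ) + 2 * I * x0 * (Real.sin γ : ℂ)) / 2 * I) =
      Complex.exp (I * γ / 2) * decayExp γ x0 := by
    rw [decayExp, ← Complex.exp_add]
    congr 1
    linear_combination (x0 : ℂ) * (Real.sin γ : ℂ) * I_sq
  have e₂ : Complex.exp (-(((γ : ℂ) + 2 * I * x0 * (Real.sin γ : ℂ)) / 2) * I) =
      Complex.exp (-(I * γ / 2)) * (decayExp γ x0)⁻¹ := by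
    rw [← exp_eq_inv_decayExp, ← Complex.exp_add]
    congr 1
    linear_combination -(x0 : ℂ) * (Real.sin γ : ℂ) * I_sq
  have e₃ : Complex.exp (((γ : ℂ) - 2 * I * x0 * (Real.sin γ : ℂ)) / 2 * I) =
      Complex.exp (I * γ / 2) * (decayExp γ x0)⁻¹ := by
    rw [← exp_eq_inv_decayExp, ← Complex.exp_add]
    congr 1
    linear_combination -(x0 : ℂ) * (Real.sin γ : ℂ) * I_sq
  have e₄ : Complex.exp (-(((γ : ℂ) - 2 * I * x0 * (Real.sin γ : ℂ)) / 2) * I) =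
      Complex.exp (-(I * γ / 2)) * decayExp γ x0 := by
    rw [decayExp, ← Complex.exp_add]
    congr 1
    linear_combination (x0 : ℂ) * (Real.sin γ : ℂ) * I_sq
  rw [zeta1sq, Complex.cos, Complex.cos, e₁, e₂, e₃, e₄,
    ← mul_div_mul_right _ _ (mul_ne_zero two_ne_zero hu)]
  congr 1 <;> field_simp

/-- The rescaled denominator `u⁶ · bDen` as a polynomial in `u = exp (-x₀ sin γ)`. -/
noncomputable def bDenScaled (γ : ℝ) (ζ u : ℂ) : ℂ :=
  (u ^ 2 + Complex.exp (I * γ)) ^ 2 * (2 * ζ ^ 2 + Complex.exp (I * γ))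
    * (I * (Real.cos γ : ℂ) + (Real.sin γ : ℂ) + I * u ^ 2)

lemma bDen_mul_decayExp_pow (γ : ℝ) (ζ : ℂ) (x0 : ℝ) :
    bDen γ ζ x0 * decayExp γ x0 ^ 6 = bDenScaled γ ζ (decayExp γ x0) := by
  have hu := decayExp_ne_zero γ x0
  rw [bDen, bDenScaled, Complex.exp_add, exp_two_eq_inv_decayExp_sq]
  field_simp

lemma continuous_bDenScaled (γ : ℝ) (ζ : ℂ) : Continuous (bDenScaled γ ζ) := by
  unfold bDenScaled
  fun_prop

lemma I_mul_cos_add_sin_ne_zero (γ : ℝ) : I * (Real.cos γ : ℂ) + (Real.sin γ : ℂ) ≠ 0 := by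
  intro h
  have hre := congrArg Complex.re h
  have him := congrArg Complex.im h
  simp only [add_re, add_im, mul_re, mul_im, I_re, I_im, ofReal_re, ofReal_im, zero_re,
    zero_im] at hre him
  nlinarith [Real.sin_sq_add_cos_sq γ]

lemma bDenScaled_zero_ne_zero (γ : ℝ) {ζ : ℂ} (hζ : 2 * ζ ^ 2 + Complex.exp (I * γ) ≠ 0) :
    bDenScaled γ ζ 0 ≠ 0 := by
  simpa [bDenScaled, hζ] using I_mul_cos_add_sin_ne_zero γ

lemma bFun_eq (γ S0 : ℝ) (ζ : ℂ) (x0 : ℝ) :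
    bFun γ S0 ζ x0 =
      2 * (Real.sqrt 2 : ℂ) * Complex.exp (-(2 * I * ((γ : ℂ) + (S0 : ℂ)))) * decayExp γ x0
        * (Complex.exp (I * γ) * decayExp γ x0 ^ 2 + 1) ^ 2 * ζ * (Real.sin γ : ℂ)
        / bDenScaled γ ζ (decayExp γ x0) := by
  have hu := decayExp_ne_zero γ x0
  rw [← bDen_mul_decayExp_pow, bFun, ← mul_div_mul_right _ (bDen γ ζ x0) (pow_ne_zero 6 hu),
    sub_eq_add_neg, Complex.exp_add, Complex.ofReal_mul, exp_eq_inv_decayExp,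
    exp_two_eq_inv_decayExp_sq]
  congr 1
  field_simp

theorem stmt13 (γ S0 : ℝ) (hγ : γ ∈ Set.Ioo 0 Real.pi) :
    Tendsto (fun x0 : ℝ => zeta1sq γ x0) atTop
      (nhds ((1 / 2) * (Complex.I * (Real.sin γ : ℂ) - (Real.cos γ : ℂ)))) ∧
    ∀ ζ : ℂ, 2 * ζ ^ 2 + Complex.exp (Complex.I * (γ : ℂ)) ≠ 0 →
      (∀ᶠ x0 : ℝ in atTop, bDen γ ζ x0 ≠ 0) ∧
      Tendsto (fun x0 : ℝ => bFun γ S0 ζ x0) atTop (nhds 0) := by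
  have hu := tendsto_decayExp hγ
  refine ⟨?_, fun ζ hζ => ?_⟩
  · have hlim : (1 / 2) * (I * (Real.sin γ : ℂ) - (Real.cos γ : ℂ)) =
        -(1 / 2) * (Complex.exp (I * γ / 2) * 0 ^ 2 + Complex.exp (-(I * γ / 2)))
          / (Complex.exp (I * γ / 2) + Complex.exp (-(I * γ / 2)) * 0 ^ 2) := by
      have hexp : Complex.exp (-(I * γ / 2)) / Complex.exp (I * γ / 2) =
          (Real.cos γ : ℂ) - (Real.sin γ : ℂ) * I := by
        have harg : -(I * γ / 2) - I * γ / 2 = -(γ : ℂ) * I := by ring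
        rw [← Complex.exp_sub, harg, Complex.exp_mul_I, Complex.cos_neg, Complex.sin_neg,
          Complex.ofReal_cos, Complex.ofReal_sin]
        ring
      linear_combination (1 / 2) * hexp
    rw [hlim]
    simp only [zeta1sq_eq]
    refine Tendsto.div ?_ ?_ (by simp)
    · exact (((hu.pow 2).const_mul _).add_const _).const_mul _
    · exact ((hu.pow 2).const_mul _).const_add _
  · have hD := ((continuous_bDenScaled γ ζ).tendsto 0).comp hu
    have hD0 := bDenScaled_zero_ne_zero γ hζ
    refine ⟨?_, ?_⟩
    · filter_upwards [hD.eventually_ne hD0] with x0 hx0 h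
      exact hx0 (by simp [← bDen_mul_decayExp_pow, h])
    · simp only [bFun_eq]
      have hN := ((((hu.const_mul (2 * (Real.sqrt 2 : ℂ)
        * Complex.exp (-(2 * I * ((γ : ℂ) + (S0 : ℂ)))))).mul
        ((((hu.pow 2).const_mul (Complex.exp (I * γ))).add_const 1).pow 2)).mul_const ζ).mul_const
        (Real.sin γ : ℂ))
      have h := hN.div hD hD0
      simp only [mul_zero, zero_mul, zero_div] at h
      exact h
end

section
/- Let u(x,t) = −2√2·e^{2it + x}/(i + e^{2x}), σ₃ = [[1,0],[0,−1]], and for ζ ∈ ℂ \ {0} let η = ζ − 1/(2ζ). Define the 2×2 matrices V₁(x,t,ζ) = [[−2i·sech(2x), −2√2·e^{2it+x}·ζ/(−i + e^{2x})],[−2√2·e^{x−2it}·ζ/(i + e^{2x}), 2i·sech(2x)]], V₂(x,t,ζ) = [[−2i·sech(2x), e^{2it−x}·(2ζ² + e^{2x}(2iζ² + 1) + i)/(√2·ζ·(−2i·cosh(x)·sinh(x) − 1))],[−√2·e^{x−2it}·(2iζ² + e^{2x}(2ζ² + i) + 1)/((i + e^{2x})²·ζ), 2i·sech(2x)]], and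 μ₃(x,t,ζ) = [[1 + 2/((−i + e^{2x})(2ζ² − i)), 2√2·e^{2it+x}·ζ/((−i + e^{2x})(1 − 2iζ²))],[2√2·e^{x−2it}·ζ/((i + e^{2x})(2iζ² + 1)), 1 + 2/((i + e^{2x})(2ζ² + i))]]. Then for all (x,t) ∈ ℝ² and all ζ ∈ ℂ with ζ ≠ 0 and 4ζ⁴ + 1 ≠ 0, μ₃ satisfies both Lax equations: ∂_x μ₃ + iζ²·(σ₃μ₃ − μ₃σ₃) = V₁·μ₃ and ∂_t μ₃ + iη²·(σ₃μ₃ − μ₃σ₃) = V₂·μ₃. -/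
open Complex Matrix

/-- The Lax matrix `V₁(x,t,ζ)` for the explicit solution `u(x,t) = -2√2 e^{2it+x}/(i+e^{2x})`. -/
noncomputable def V1e (p : ℝ × ℝ) (ζ : ℂ) : Matrix (Fin 2) (Fin 2) ℂ :=
  !![-2 * Complex.I * ((Real.cosh (2 * p.1) : ℂ))⁻¹,
      -2 * (Real.sqrt 2 : ℂ) * Complex.exp (2 * Complex.I * (p.2 : ℂ) + (p.1 : ℂ)) * ζ
        / (-Complex.I + Complex.exp (2 * (p.1 : ℂ)));
    -2 * (Real.sqrt 2 : ℂ) * Complex.exp ((p.1 : ℂ) - 2 * Complex.I * (p.2 : ℂ)) * ζ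
        / (Complex.I + Complex.exp (2 * (p.1 : ℂ))),
      2 * Complex.I * ((Real.cosh (2 * p.1) : ℂ))⁻¹]

/-- The Lax matrix `V₂(x,t,ζ)` for the explicit solution `u(x,t) = -2√2 e^{2it+x}/(i+e^{2x})`. -/
noncomputable def V2e (p : ℝ × ℝ) (ζ : ℂ) : Matrix (Fin 2) (Fin 2) ℂ :=
  !![-2 * Complex.I * ((Real.cosh (2 * p.1) : ℂ))⁻¹,
      Complex.exp (2 * Complex.I * (p.2 : ℂ) - (p.1 : ℂ))
          * (2 * ζ ^ 2 + Complex.exp (2 * (p.1 : ℂ)) * (2 * Complex.I * ζ ^ 2 + 1) + Complex.I)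
        / ((Real.sqrt 2 : ℂ) * ζ
            * (-2 * Complex.I * (Real.cosh p.1 : ℂ) * (Real.sinh p.1 : ℂ) - 1));
    -(Real.sqrt 2 : ℂ) * Complex.exp ((p.1 : ℂ) - 2 * Complex.I * (p.2 : ℂ))
          * (2 * Complex.I * ζ ^ 2 + Complex.exp (2 * (p.1 : ℂ)) * (2 * ζ ^ 2 + Complex.I) + 1)
        / ((Complex.I + Complex.exp (2 * (p.1 : ℂ))) ^ 2 * ζ),
      2 * Complex.I * ((Real.cosh (2 * p.1) : ℂ))⁻¹]

/-- The eigenfunction `μ₃(x,t,ζ)` for the explicit solution. -/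
noncomputable def mu3e (p : ℝ × ℝ) (ζ : ℂ) : Matrix (Fin 2) (Fin 2) ℂ :=
  !![1 + 2 / ((-Complex.I + Complex.exp (2 * (p.1 : ℂ))) * (2 * ζ ^ 2 - Complex.I)),
      2 * (Real.sqrt 2 : ℂ) * Complex.exp (2 * Complex.I * (p.2 : ℂ) + (p.1 : ℂ)) * ζ
        / ((-Complex.I + Complex.exp (2 * (p.1 : ℂ))) * (1 - 2 * Complex.I * ζ ^ 2));
    2 * (Real.sqrt 2 : ℂ) * Complex.exp ((p.1 : ℂ) - 2 * Complex.I * (p.2 : ℂ)) * ζ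
        / ((Complex.I + Complex.exp (2 * (p.1 : ℂ))) * (2 * Complex.I * ζ ^ 2 + 1)),
      1 + 2 / ((Complex.I + Complex.exp (2 * (p.1 : ℂ))) * (2 * ζ ^ 2 + Complex.I))]

theorem add_cexp_two_mul_ne_zero {w : ℂ} (hw : w.im ≠ 0) (x : ℝ) :
    w + cexp (2 * (x : ℂ)) ≠ 0 := by
  intro h
  have h' := congrArg Complex.im h
  have hE : (cexp (2 * (x : ℂ))).im = 0 := by
    rw [show (2 * (x : ℂ)) = ((2 * x : ℝ) : ℂ) by push_cast; rfl, Complex.exp_ofReal_im]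
  rw [Complex.add_im, hE, add_zero, Complex.zero_im] at h'
  exact hw h'

theorem dX_eq_of_hasDerivAt {f : ℝ × ℝ → ℂ} {p : ℝ × ℝ} {d : ℂ} (hf : DifferentiableAt ℝ f p)
    (h : HasDerivAt (fun s : ℝ => f (s, p.2)) d p.1) : dX f p = d := by
  have hl : HasDerivAt (fun s : ℝ => (s, p.2)) ((1 : ℝ), (0 : ℝ)) p.1 :=
    (hasDerivAt_id p.1).prodMk (hasDerivAt_const p.1 p.2)
  exact (hf.hasFDerivAt.comp_hasDerivAt p.1 hl).unique h

theorem dT_eq_of_hasDerivAt {f : ℝ × ℝ → ℂ} {p : ℝ × ℝ} {d : ℂ} (hf : DifferentiableAt ℝ f p)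
    (h : HasDerivAt (fun s : ℝ => f (p.1, s)) d p.2) : dT f p = d := by
  have hl : HasDerivAt (fun s : ℝ => (p.1, s)) ((0 : ℝ), (1 : ℝ)) p.2 :=
    (hasDerivAt_const p.2 p.1).prodMk (hasDerivAt_id p.2)
  exact (hf.hasFDerivAt.comp_hasDerivAt p.2 hl).unique h

theorem hasDerivAt_cexp_ofReal_mul (a b : ℂ) (x : ℝ) :
    HasDerivAt (fun s : ℝ => cexp (a * (s : ℂ) + b)) (cexp (a * (x : ℂ) + b) * a) x := by
  have h : HasDerivAt (fun z : ℂ => cexp (a * z + b)) (cexp (a * (x : ℂ) + b) * a) (x : ℂ) := by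
    simpa using (((hasDerivAt_id (x : ℂ)).const_mul a).add_const b).cexp
  exact h.comp_ofReal

theorem differentiableAt_cexp_mul_div {w c : ℂ} (hw : w.im ≠ 0) (hc : c ≠ 0) (k a b : ℂ)
    (p : ℝ × ℝ) :
    DifferentiableAt ℝ (fun q : ℝ × ℝ => k * cexp (a * (q.1 : ℂ) + b * (q.2 : ℂ))
      / ((w + cexp (2 * (q.1 : ℂ))) * c)) p := by
  have h1 : DifferentiableAt ℝ (fun q : ℝ × ℝ => (q.1 : ℂ)) p :=
    Complex.ofRealCLM.differentiableAt.comp p differentiableAt_fst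
  have h2 : DifferentiableAt ℝ (fun q : ℝ × ℝ => (q.2 : ℂ)) p :=
    Complex.ofRealCLM.differentiableAt.comp p differentiableAt_snd
  simp only [div_eq_mul_inv]
  exact ((((h1.const_mul a).add (h2.const_mul b)).cexp).const_mul k).fun_mul
    (((((h1.const_mul 2).cexp).const_add w).mul_const c).fun_inv
      (mul_ne_zero (add_cexp_two_mul_ne_zero hw p.1) hc))

theorem dX_cexp_mul_div {w c : ℂ} (hw : w.im ≠ 0) (hc : c ≠ 0) (k a b : ℂ) (p : ℝ × ℝ) :
    dX (fun q : ℝ × ℝ => k * cexp (a * (q.1 : ℂ) + b * (q.2 : ℂ))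
      / ((w + cexp (2 * (q.1 : ℂ))) * c)) p
      = k * cexp (a * (p.1 : ℂ) + b * (p.2 : ℂ))
        * (a * (w + cexp (2 * (p.1 : ℂ))) - 2 * cexp (2 * (p.1 : ℂ)))
        / ((w + cexp (2 * (p.1 : ℂ))) ^ 2 * c) := by
  have hd := add_cexp_two_mul_ne_zero hw p.1
  refine dX_eq_of_hasDerivAt (differentiableAt_cexp_mul_div hw hc k a b p) ?_
  have h2 : HasDerivAt (fun s : ℝ => cexp (2 * (s : ℂ))) (cexp (2 * (p.1 : ℂ)) * 2) p.1 := by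
    simpa using hasDerivAt_cexp_ofReal_mul 2 0 p.1
  refine (((hasDerivAt_cexp_ofReal_mul a (b * (p.2 : ℂ)) p.1).const_mul k).fun_div
    ((h2.const_add w).mul_const c) (mul_ne_zero hd hc)).congr_deriv ?_
  field_simp

theorem dT_cexp_mul_div {w c : ℂ} (hw : w.im ≠ 0) (hc : c ≠ 0) (k a b : ℂ) (p : ℝ × ℝ) :
    dT (fun q : ℝ × ℝ => k * cexp (a * (q.1 : ℂ) + b * (q.2 : ℂ))
      / ((w + cexp (2 * (q.1 : ℂ))) * c)) p
      = b * (k * cexp (a * (p.1 : ℂ) + b * (p.2 : ℂ))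
        / ((w + cexp (2 * (p.1 : ℂ))) * c)) := by
  refine dT_eq_of_hasDerivAt (differentiableAt_cexp_mul_div hw hc k a b p) ?_
  have h := ((hasDerivAt_cexp_ofReal_mul b (a * (p.1 : ℂ)) p.2).const_mul k).div_const
    ((w + cexp (2 * (p.1 : ℂ))) * c)
  simp only [add_comm (b * _) (a * _)] at h
  exact h.congr_deriv (by ring)

theorem dX_const_add (c : ℂ) (f : ℝ × ℝ → ℂ) (p : ℝ × ℝ) :
    dX (fun q => c + f q) p = dX f p := by
  simp only [dX, fderiv_const_add]

theorem dT_const_add (c : ℂ) (f : ℝ × ℝ → ℂ) (p : ℝ × ℝ) :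
    dT (fun q => c + f q) p = dT f p := by
  simp only [dT, fderiv_const_add]

theorem stmt15 :
    ∀ (p : ℝ × ℝ) (ζ : ℂ), ζ ≠ 0 → 4 * ζ ^ 4 + 1 ≠ 0 →
      (Matrix.of fun i j => dX (fun q => mu3e q ζ i j) p)
          + (Complex.I * ζ ^ 2) • (sigma3 * mu3e p ζ - mu3e p ζ * sigma3)
        = V1e p ζ * mu3e p ζ ∧
      (Matrix.of fun i j => dT (fun q => mu3e q ζ i j) p)
          + (Complex.I * (ζ - 1 / (2 * ζ)) ^ 2) • (sigma3 * mu3e p ζ - mu3e p ζ * sigma3)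
        = V2e p ζ * mu3e p ζ := by
  intro p ζ hζ hζ4
  have hc : 2 * ζ ^ 2 - I ≠ 0 := fun h => hζ4 (by
    linear_combination (2 * ζ ^ 2 + I) * h + I_sq)
  have hc' : 2 * ζ ^ 2 + I ≠ 0 := fun h => hζ4 (by
    linear_combination (2 * ζ ^ 2 - I) * h + I_sq)
  have hk : 1 - 2 * I * ζ ^ 2 ≠ 0 := fun h => hc' (by linear_combination I * h + 2 * ζ ^ 2 * I_sq)
  have hk' : 2 * I * ζ ^ 2 + 1 ≠ 0 := fun h => hc (by
    linear_combination (-I) * h + 2 * ζ ^ 2 * I_sq)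
  have hI : (-I).im ≠ 0 := by simp
  have hI' : I.im ≠ 0 := by simp
  have e11 : (fun q => mu3e q ζ 0 0) = fun q : ℝ × ℝ => 1 + 2 * cexp (0 * (q.1 : ℂ) + 0 * (q.2 : ℂ))
      / ((-I + cexp (2 * (q.1 : ℂ))) * (2 * ζ ^ 2 - I)) := by
    funext q; simp [mu3e]
  have e12 : (fun q => mu3e q ζ 0 1) = fun q : ℝ × ℝ => (2 * (√2 : ℂ) * ζ)
      * cexp (1 * (q.1 : ℂ) + 2 * I * (q.2 : ℂ))
      / ((-I + cexp (2 * (q.1 : ℂ))) * (1 - 2 * I * ζ ^ 2)) := by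
    funext q; simp only [mu3e, of_apply, cons_val', cons_val_zero, cons_val_one, cons_val_fin_one]
    rw [show (1 : ℂ) * (q.1 : ℂ) + 2 * I * (q.2 : ℂ) = 2 * I * (q.2 : ℂ) + q.1 by ring]; ring
  have e21 : (fun q => mu3e q ζ 1 0) = fun q : ℝ × ℝ => (2 * (√2 : ℂ) * ζ)
      * cexp (1 * (q.1 : ℂ) + (-2 * I) * (q.2 : ℂ))
      / ((I + cexp (2 * (q.1 : ℂ))) * (2 * I * ζ ^ 2 + 1)) := by
    funext q; simp only [mu3e, of_apply, cons_val', cons_val_zero, cons_val_one, cons_val_fin_one]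
    rw [show (1 : ℂ) * (q.1 : ℂ) + (-2 * I) * (q.2 : ℂ) = q.1 - 2 * I * (q.2 : ℂ) by ring]; ring
  have e22 : (fun q => mu3e q ζ 1 1) = fun q : ℝ × ℝ => 1 + 2 * cexp (0 * (q.1 : ℂ) + 0 * (q.2 : ℂ))
      / ((I + cexp (2 * (q.1 : ℂ))) * (2 * ζ ^ 2 + I)) := by
    funext q; simp [mu3e]
  have hd := add_cexp_two_mul_ne_zero hI p.1
  have hd' := add_cexp_two_mul_ne_zero hI' p.1
  have hX := Complex.exp_ne_zero (p.1 : ℂ)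
  have hT := Complex.exp_ne_zero (2 * I * (p.2 : ℂ))
  have hr : (√2 : ℂ) ^ 2 = 2 := by norm_cast; simp
  have hr0 : (√2 : ℂ) ≠ 0 := by intro h; simp [h] at hr
  have hE : cexp (2 * (p.1 : ℂ)) = cexp (p.1 : ℂ) ^ 2 := by rw [← Complex.exp_nat_mul]; norm_num
  have hch : ((Real.cosh (2 * p.1) : ℂ))⁻¹ = 2 * cexp (p.1 : ℂ) ^ 2
      / ((-I + cexp (p.1 : ℂ) ^ 2) * (I + cexp (p.1 : ℂ) ^ 2)) := by
    rw [hE] at hd hd'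
    rw [show (-I + cexp (p.1 : ℂ) ^ 2) * (I + cexp (p.1 : ℂ) ^ 2) = cexp (p.1 : ℂ) ^ 4 + 1 by
      linear_combination -I_sq]
    push_cast
    rw [Complex.cosh, Complex.exp_neg, hE, inv_eq_iff_eq_inv, inv_div]
    field_simp
  have hcs : -2 * I * (Real.cosh p.1 : ℂ) * (Real.sinh p.1 : ℂ) - 1
      = -I * (-I + cexp (p.1 : ℂ) ^ 2) ^ 2 / (2 * cexp (p.1 : ℂ) ^ 2) := by
    push_cast
    rw [Complex.cosh, Complex.sinh, Complex.exp_neg]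
    field_simp
    linear_combination (I + -2 * cexp (p.1 : ℂ) ^ 2) * I_sq
  have hp : cexp (2 * I * (p.2 : ℂ) + (p.1 : ℂ)) = cexp (2 * I * (p.2 : ℂ)) * cexp (p.1 : ℂ) :=
    Complex.exp_add _ _
  have hm : cexp ((p.1 : ℂ) - 2 * I * (p.2 : ℂ)) = cexp (p.1 : ℂ) / cexp (2 * I * (p.2 : ℂ)) :=
    Complex.exp_sub _ _
  have hm' : cexp (2 * I * (p.2 : ℂ) - (p.1 : ℂ)) = cexp (2 * I * (p.2 : ℂ)) / cexp (p.1 : ℂ) :=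
    Complex.exp_sub _ _
  have hq : cexp (1 * (p.1 : ℂ) + 2 * I * (p.2 : ℂ)) = cexp (2 * I * (p.2 : ℂ)) * cexp (p.1 : ℂ) := by
    rw [← hp]; ring_nf
  have hq' : cexp (1 * (p.1 : ℂ) + (-2 * I) * (p.2 : ℂ))
      = cexp (p.1 : ℂ) / cexp (2 * I * (p.2 : ℂ)) := by
    rw [← hm]; ring_nf
  have x12 := dX_cexp_mul_div hI hk (2 * (√2 : ℂ) * ζ) 1 (2 * I) p
  have x21 := dX_cexp_mul_div hI' hk' (2 * (√2 : ℂ) * ζ) 1 (-2 * I) p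
  have x11 := dX_cexp_mul_div hI hc 2 0 0 p
  have x22 := dX_cexp_mul_div hI' hc' 2 0 0 p
  have t12 := dT_cexp_mul_div hI hk (2 * (√2 : ℂ) * ζ) 1 (2 * I) p
  have t21 := dT_cexp_mul_div hI' hk' (2 * (√2 : ℂ) * ζ) 1 (-2 * I) p
  have t11 := dT_cexp_mul_div hI hc 2 0 0 p
  have t22 := dT_cexp_mul_div hI' hc' 2 0 0 p
  rw [← dX_const_add 1, ← e11] at x11
  rw [← dX_const_add 1, ← e22] at x22
  rw [← dT_const_add 1, ← e11] at t11
  rw [← dT_const_add 1, ← e22] at t22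
  rw [← e12] at x12 t12
  rw [← e21] at x21 t21
  rw [hE] at hd hd'
  have hz : cexp (0 * (p.1 : ℂ) + 0 * (p.2 : ℂ)) = 1 := by simp
  have k1 : 1 - 2 * I * ζ ^ 2 = -I * (2 * ζ ^ 2 + I) := by linear_combination I_sq
  have k2 : 2 * I * ζ ^ 2 + 1 = I * (2 * ζ ^ 2 - I) := by linear_combination I_sq
  rw [hq, hE, k1] at x12 t12
  rw [hq', hE, k2] at x21 t21
  rw [hz, hE] at x11 t11 x22 t22
  constructor
  · ext i j
    fin_cases i <;> fin_cases j
    all_goals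
      simp only [Fin.zero_eta, Fin.mk_one, Fin.isValue, Matrix.add_apply, of_apply,
        Matrix.smul_apply, Matrix.sub_apply, smul_eq_mul, mul_apply, Fin.sum_univ_two,
        x11, x12, x21, x22]
      simp only [mu3e, V1e, sigma3, of_apply, cons_val', cons_val_zero, cons_val_one,
        cons_val_fin_one, hch, hp, hm, hE, k1, k2]
      clear x11 x12 x21 x22 t11 t12 t21 t22 e11 e12 e21 e22 hp hm hm' hq hq' hch hcs hE
      generalize cexp (p.1 : ℂ) = X at *
      generalize cexp (2 * I * (p.2 : ℂ)) = T at *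
      generalize (√2 : ℂ) = r at *
      have hI0 := I_ne_zero
      have hI2 := I_sq
      generalize I = J at *
      field_simp
      grind
  · ext i j
    fin_cases i <;> fin_cases j
    all_goals
      simp only [Fin.zero_eta, Fin.mk_one, Fin.isValue, Matrix.add_apply, of_apply,
        Matrix.smul_apply, Matrix.sub_apply, smul_eq_mul, mul_apply, Fin.sum_univ_two,
        t11, t12, t21, t22]
      simp only [mu3e, V2e, sigma3, of_apply, cons_val', cons_val_zero, cons_val_one,
        cons_val_fin_one, hch, hcs, hp, hm, hm', hE, k1, k2]
      clear x11 x12 x21 x22 t11 t12 t21 t22 e11 e12 e21 e22 hp hm hm' hq hq' hch hcs hE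
      generalize cexp (p.1 : ℂ) = X at *
      generalize cexp (2 * I * (p.2 : ℂ)) = T at *
      generalize (√2 : ℂ) = r at *
      have hI0 := I_ne_zero
      have hI2 := I_sq
      generalize I = J at *
      field_simp
      grind
end

section
/- Let T ∈ ℝ. For ζ ∈ ℂ \ {0} let η = ζ − 1/(2ζ). Define a(ζ) = (2ζ² + 1)/(2ζ² + i), b(ζ) = −(1 − i)·√2·ζ/(2ζ² + i), A*(ζ) = (η² − e^{−2iT(η² + 1)} + 2)/(η² + 1), and B*(ζ) = −2·e^{−3πi/4}·(−1 + e^{−2iT(η² + 1)})·ζ·(η² + 2)/((2ζ² + 1)·(η² + 1)). Then for every ζ ∈ ℂ \ {0} with 2ζ² + i ≠ 0, 2ζ² + 1 ≠ 0, and η² + 1 ≠ 0: a(ζ)·A*(ζ) − b(ζ)·B*(ζ) = (2ζ² + 1)/(2ζ² + i). In particular the left-hand side is independent of T. -/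
open Complex

/-- `η(ζ) = ζ - 1/(2ζ)`. -/
noncomputable def etaF (ζ : ℂ) : ℂ := ζ - 1 / (2 * ζ)

/-- The spectral function `a(ζ) = (2ζ² + 1)/(2ζ² + i)`. -/
noncomputable def aF (ζ : ℂ) : ℂ := (2 * ζ ^ 2 + 1) / (2 * ζ ^ 2 + Complex.I)

/-- The spectral function `b(ζ) = -(1-i)√2 ζ/(2ζ² + i)`. -/
noncomputable def bF (ζ : ℂ) : ℂ :=
  -((1 - Complex.I) * (Real.sqrt 2 : ℂ) * ζ) / (2 * ζ ^ 2 + Complex.I)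

/-- The Schwartz conjugate `A*(ζ) = (η² - e^{-2iT(η²+1)} + 2)/(η² + 1)`. -/
noncomputable def AstarF (T : ℝ) (ζ : ℂ) : ℂ :=
  (etaF ζ ^ 2 - Complex.exp (-2 * Complex.I * (T : ℂ) * (etaF ζ ^ 2 + 1)) + 2)
    / (etaF ζ ^ 2 + 1)

/-- The Schwartz conjugate
`B*(ζ) = -2 e^{-3πi/4}(-1 + e^{-2iT(η²+1)}) ζ (η²+2)/((2ζ²+1)(η²+1))`. -/
noncomputable def BstarF (T : ℝ) (ζ : ℂ) : ℂ :=
  -2 * Complex.exp (-3 * (Real.pi : ℂ) * Complex.I / 4)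
      * (-1 + Complex.exp (-2 * Complex.I * (T : ℂ) * (etaF ζ ^ 2 + 1)))
      * ζ * (etaF ζ ^ 2 + 2)
    / ((2 * ζ ^ 2 + 1) * (etaF ζ ^ 2 + 1))

theorem exp_neg_three_pi_I_div_four :
    Complex.exp (-3 * (Real.pi : ℂ) * Complex.I / 4) = -((1 + Complex.I) * (Real.sqrt 2 : ℂ) / 2) := by
  have h : (-3 * (Real.pi : ℂ) * Complex.I / 4)
      = ((Real.pi / 4 : ℝ) : ℂ) * Complex.I - Real.pi * Complex.I := by
    push_cast; ring
  rw [h, Complex.exp_sub, Complex.exp_pi_mul_I, Complex.exp_mul_I, ← Complex.ofReal_cos,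
    ← Complex.ofReal_sin, Real.cos_pi_div_four, Real.sin_pi_div_four]
  push_cast
  ring

theorem one_sub_I_mul_sqrt_two_mul_exp :
    (1 - Complex.I) * (Real.sqrt 2 : ℂ) * Complex.exp (-3 * (Real.pi : ℂ) * Complex.I / 4) = -2 := by
  have h2 : (Real.sqrt 2 : ℂ) ^ 2 = 2 := by
    rw [← Complex.ofReal_pow, Real.sq_sqrt (by norm_num)]; norm_num
  rw [exp_neg_three_pi_I_div_four]
  linear_combination (Real.sqrt 2 : ℂ) ^ 2 / 2 * Complex.I_sq - h2

theorem etaF_sq_add_two {ζ : ℂ} (hζ : ζ ≠ 0) :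
    4 * ζ ^ 2 * (etaF ζ ^ 2 + 2) = (2 * ζ ^ 2 + 1) ^ 2 := by
  unfold etaF
  field_simp
  ring

theorem stmt17 (T : ℝ) :
    ∀ ζ : ℂ, ζ ≠ 0 → 2 * ζ ^ 2 + Complex.I ≠ 0 → 2 * ζ ^ 2 + 1 ≠ 0 →
      etaF ζ ^ 2 + 1 ≠ 0 →
      aF ζ * AstarF T ζ - bF ζ * BstarF T ζ = (2 * ζ ^ 2 + 1) / (2 * ζ ^ 2 + Complex.I) := by
  intro ζ hζ hD hN hη
  have hc := one_sub_I_mul_sqrt_two_mul_exp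
  have he := etaF_sq_add_two hζ
  unfold aF bF AstarF BstarF
  generalize Complex.exp (-2 * Complex.I * (T : ℂ) * (etaF ζ ^ 2 + 1)) = E
  generalize Complex.exp (-3 * (Real.pi : ℂ) * Complex.I / 4) = w at *
  generalize etaF ζ = η at *
  rw [div_mul_div_comm, div_mul_div_comm, div_sub_div _ _ (by positivity) (by positivity),
    div_eq_div_iff (by positivity) hD]
  linear_combination (-2 * (E - 1) * ζ ^ 2 * (η ^ 2 + 2) * (2 * ζ ^ 2 + Complex.I) ^ 2 * (η ^ 2 + 1)) * hc
    + ((E - 1) * (2 * ζ ^ 2 + Complex.I) ^ 2 * (η ^ 2 + 1)) * he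
end

section
/- Define a(ζ) = (2ζ² + 1)/(2ζ² + i) and b(ζ) = −(1 − i)·√2·ζ/(2ζ² + i), and their Schwartz conjugates a*(ζ) = conj(a(conj ζ)) = (2ζ² + 1)/(2ζ² − i), b*(ζ) = conj(b(conj ζ)) = −(1 + i)·√2·ζ/(2ζ² − i). Let n(ζ) = (e^{iα} + 2iζ²)/(i + 2e^{iα}ζ²) with α = π/2, i.e. e^{iα} = i. Then: (i) n(ζ) = 1 for every ζ with 1 + 2ζ² ≠ 0; (ii) for every ζ ∈ ℂ \ {0} with 2ζ² + i ≠ 0 and 2ζ² − i·(2ζ)^{-2}-type denominators nonzero (explicitly: 1 − 2iζ² ≠ 0), the function 𝒟(ζ) := a(ζ)·a*(1/(2ζ)) − b(ζ)·b*(1/(2ζ))·n(ζ) equals (2iζ² + 1)/(2ζ² + i); (iii) the zeros of 𝒟 are exactly ζ = (1 + i)/2 and ζ = −(1 + i)/2, i.e. the solutions of ζ² = i/2, which coincide with the zeros ±ζ₁^{line} of the full-line spectral function of the soliton. -/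
open Complex

/-- The Schwartz conjugate `a*(ζ) = conj (a (conj ζ)) = (2ζ² + 1)/(2ζ² - i)`. -/
noncomputable def aS (ζ : ℂ) : ℂ := (2 * ζ ^ 2 + 1) / (2 * ζ ^ 2 - Complex.I)

/-- The Schwartz conjugate `b*(ζ) = conj (b (conj ζ)) = -(1+i)√2 ζ/(2ζ² - i)`. -/
noncomputable def bS (ζ : ℂ) : ℂ :=
  -((1 + Complex.I) * (Real.sqrt 2 : ℂ) * ζ) / (2 * ζ ^ 2 - Complex.I)

/-- `n(ζ) = (e^{iα} + 2iζ²)/(i + 2e^{iα}ζ²)` with `α = π/2`. -/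
noncomputable def nF (ζ : ℂ) : ℂ :=
  (Complex.exp (Complex.I * ((Real.pi / 2 : ℝ) : ℂ)) + 2 * Complex.I * ζ ^ 2)
    / (Complex.I + 2 * Complex.exp (Complex.I * ((Real.pi / 2 : ℝ) : ℂ)) * ζ ^ 2)

/-- `𝒟(ζ) = a(ζ) a*(1/(2ζ)) - b(ζ) b*(1/(2ζ)) n(ζ)`. -/
noncomputable def calD (ζ : ℂ) : ℂ :=
  aF ζ * aS (1 / (2 * ζ)) - bF ζ * bS (1 / (2 * ζ)) * nF ζ

theorem nF_eq_one {ζ : ℂ} (h : 1 + 2 * ζ ^ 2 ≠ 0) : nF ζ = 1 := by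
  have hexp : Complex.exp (Complex.I * ((Real.pi / 2 : ℝ) : ℂ)) = Complex.I := by
    rw [mul_comm]
    push_cast
    exact Complex.exp_pi_div_two_mul_I
  have hne : Complex.I + 2 * Complex.I * ζ ^ 2 ≠ 0 := by
    have : Complex.I + 2 * Complex.I * ζ ^ 2 = Complex.I * (1 + 2 * ζ ^ 2) := by ring
    rw [this]
    exact mul_ne_zero Complex.I_ne_zero h
  rw [nF, hexp, div_self hne]

theorem aS_eq_conj : aS = fun ζ => (starRingEnd ℂ) (aF ((starRingEnd ℂ) ζ)) := by
  funext ζ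
  simp [aS, aF, sub_eq_add_neg, Complex.conj_ofNat]

theorem bS_eq_conj : bS = fun ζ => (starRingEnd ℂ) (bF ((starRingEnd ℂ) ζ)) := by
  funext ζ
  simp [bS, bF, sub_eq_add_neg, Complex.conj_ofNat]

theorem aS_one_div_two_mul {ζ : ℂ} (h0 : ζ ≠ 0) :
    aS (1 / (2 * ζ)) = (1 + 2 * ζ ^ 2) / (1 - 2 * Complex.I * ζ ^ 2) := by
  have hc : 2 * ζ ^ 2 ≠ 0 := by simpa using h0
  rw [aS, ← mul_div_mul_left _ _ hc]
  congr 1 <;> field_simp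

theorem bS_one_div_two_mul {ζ : ℂ} (h0 : ζ ≠ 0) :
    bS (1 / (2 * ζ)) =
      -((1 + Complex.I) * (Real.sqrt 2 : ℂ) * ζ) / (1 - 2 * Complex.I * ζ ^ 2) := by
  have hc : 2 * ζ ^ 2 ≠ 0 := by simpa using h0
  rw [bS, ← mul_div_mul_left _ _ hc]
  congr 1 <;> field_simp

theorem calD_eq {ζ : ℂ} (h0 : ζ ≠ 0) (h1 : 2 * ζ ^ 2 + Complex.I ≠ 0)
    (h2 : 1 - 2 * Complex.I * ζ ^ 2 ≠ 0) (h3 : 1 + 2 * ζ ^ 2 ≠ 0) :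
    calD ζ = (2 * Complex.I * ζ ^ 2 + 1) / (2 * ζ ^ 2 + Complex.I) := by
  have hs : (Real.sqrt 2 : ℂ) ^ 2 = 2 := by
    exact_mod_cast Real.sq_sqrt (zero_le_two : (0 : ℝ) ≤ 2)
  rw [calD, nF_eq_one h3, aS_one_div_two_mul h0, bS_one_div_two_mul h0, aF, bF, mul_one,
    div_mul_div_comm, div_mul_div_comm, ← sub_div, div_eq_div_iff (mul_ne_zero h1 h2) h1]
  linear_combination
    (-(1 - Complex.I ^ 2) * ζ ^ 2 * (2 * ζ ^ 2 + Complex.I)) * hs +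
      (2 * ζ ^ 2 + 4 * ζ ^ 4) * (2 * ζ ^ 2 + Complex.I) * Complex.I_sq

theorem eq_or_eq_neg_iff_sq_eq_I_div_two (ζ : ℂ) :
    ζ = (1 + Complex.I) / 2 ∨ ζ = -((1 + Complex.I) / 2) ↔ ζ ^ 2 = Complex.I / 2 := by
  have hsq : ((1 + Complex.I) / 2) ^ 2 = Complex.I / 2 := by
    linear_combination Complex.I_sq / 4
  rw [← hsq, sq_eq_sq_iff_eq_or_eq_neg]

theorem calD_eq_zero_iff {ζ : ℂ} (h0 : ζ ≠ 0) (h1 : 2 * ζ ^ 2 + Complex.I ≠ 0)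
    (h2 : 1 - 2 * Complex.I * ζ ^ 2 ≠ 0) (h3 : 1 + 2 * ζ ^ 2 ≠ 0) :
    calD ζ = 0 ↔ ζ = (1 + Complex.I) / 2 ∨ ζ = -((1 + Complex.I) / 2) := by
  rw [calD_eq h0 h1 h2 h3, eq_or_eq_neg_iff_sq_eq_I_div_two, div_eq_zero_iff, or_iff_left h1]
  constructor <;> intro h
  · linear_combination -(Complex.I / 2) * h + ζ ^ 2 * Complex.I_sq
  · linear_combination 2 * Complex.I * h + Complex.I_sq

theorem stmt18 :
    (∀ ζ : ℂ, 1 + 2 * ζ ^ 2 ≠ 0 → nF ζ = 1) ∧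
    (aS = fun ζ => (starRingEnd ℂ) (aF ((starRingEnd ℂ) ζ))) ∧
    (bS = fun ζ => (starRingEnd ℂ) (bF ((starRingEnd ℂ) ζ))) ∧
    (∀ ζ : ℂ, ζ ≠ 0 → 2 * ζ ^ 2 + Complex.I ≠ 0 → 1 - 2 * Complex.I * ζ ^ 2 ≠ 0 →
      1 + 2 * ζ ^ 2 ≠ 0 →
      calD ζ = (2 * Complex.I * ζ ^ 2 + 1) / (2 * ζ ^ 2 + Complex.I)) ∧
    (∀ ζ : ℂ, ζ ≠ 0 → 2 * ζ ^ 2 + Complex.I ≠ 0 → 1 - 2 * Complex.I * ζ ^ 2 ≠ 0 →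
      1 + 2 * ζ ^ 2 ≠ 0 →
      (calD ζ = 0 ↔ ζ = (1 + Complex.I) / 2 ∨ ζ = -((1 + Complex.I) / 2))) ∧
    (∀ ζ : ℂ, ζ = (1 + Complex.I) / 2 ∨ ζ = -((1 + Complex.I) / 2) ↔ ζ ^ 2 = Complex.I / 2) := by
  exact ⟨fun _ => nF_eq_one, aS_eq_conj, bS_eq_conj, fun _ => calD_eq,
    fun _ => calD_eq_zero_iff, eq_or_eq_neg_iff_sq_eq_I_div_two⟩
end
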